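/- With μ = μ_φ a Gibbs measure for the Gauss map with Lyapunov exponent λ and dimension s, and with the regular sets R_m and rate δ = δ(ε/2)/2 as in the regularity decomposition: suppose α, β > 0 with γ = α + β ≥ 1, and let f : [0,1] → ℂ be C¹ with ‖f‖_∞ ≤ 1 and ‖f′‖_∞ ≤ e^{αλn} for some n ≥ n₀. Then there is a constant (independent of n, f) such that ∫|f(x)| dμ(x) ≪ e^{(−βλ + εγ)n} + ‖f‖₂² e^{((1−s)αλ + (3−s)βλ + 3λεγ)n} + e^{−δγn/4}, where ‖f‖₂ is the L² norm of f with respect to Lebesgue measure on [0,1]. -/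

import Mathlib

open MeasureTheory Filter Set Topology
open scoped ENNReal NNReal Classical Real

noncomputable section

/-- The Gauss map `T(x) = 1/x mod 1`. -/
def gaussMap (x : ℝ) : ℝ := Int.fract x⁻¹

/-- The space `X = [0,1] ∖ ℚ` of irrational numbers in the unit interval. -/
def gaussSet : Set ℝ := {x | x ∈ Set.Icc (0:ℝ) 1 ∧ Irrational x}

/-- The first continued fraction digit `a₁(x) = ⌊1/x⌋`. -/
def cfDigit1 (x : ℝ) : ℕ := ⌊x⁻¹⌋₊

/-- The `(i+1)`-th continued fraction digit `a_{i+1}(x) = a₁(Tⁱ x)`. -/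
def cfDigit (i : ℕ) (x : ℝ) : ℕ := cfDigit1 (gaussMap^[i] x)

/-- The inverse branch `T_a(x) = 1/(x+a)` of the Gauss map. -/
def invBranch1 (a : ℕ) (x : ℝ) : ℝ := (x + (a : ℝ))⁻¹

/-- The composed inverse branch `T_𝐚 = T_{a₁} ∘ ⋯ ∘ T_{aₙ}` for `𝐚 = [a₁,…,aₙ]`. -/
def invBranch (l : List ℕ) (x : ℝ) : ℝ := l.foldr invBranch1 x

/-- The cylinder set `I_𝐚` of points of `X` whose first digits are given by `𝐚`. -/
def cylinder (l : List ℕ) : Set ℝ :=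
  {x | x ∈ gaussSet ∧ ∀ i : Fin l.length, cfDigit i.1 x = l.get i}

/-- The Birkhoff sum `S_n φ = ∑_{k<n} φ ∘ T^k`. -/
def birkhoff (φ : ℝ → ℝ) (n : ℕ) (x : ℝ) : ℝ :=
  ∑ k ∈ Finset.range n, φ (gaussMap^[k] x)

/-- The pair `(pₙ(𝐚), qₙ(𝐚))` of numerator and denominator (continuant) of the
finite continued fraction `[a₁,…,aₙ] = pₙ/qₙ`. -/
def contPQ : List ℕ → ℕ × ℕ
  | [] => (0, 1)
  | a :: l => ((contPQ l).2, a * (contPQ l).2 + (contPQ l).1)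

/-- The continuant `qₙ(𝐚)`, the denominator of `[a₁,…,aₙ]` in lowest terms. -/
def contQ (l : List ℕ) : ℕ := (contPQ l).2

/-- Words of length `n` with digits in `ℕ = {1,2,…}`. -/
def Word (n : ℕ) : Type := {l : List ℕ // l.length = n ∧ ∀ a ∈ l, 0 < a}

/-- The periodic point `𝐚^∞` with periodic continued fraction expansion repeating `𝐚`. -/
def periodicPoint (l : List ℕ) : ℝ :=
  limUnder atTop fun k : ℕ => invBranch (List.flatten (List.replicate k l)) (1/2 : ℝ)

/-- The `n`-th partition sum `∑_{𝐚 ∈ ℕⁿ} exp(S_nφ(𝐚^∞))` appearing in the pressure. -/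
def partSum (φ : ℝ → ℝ) (n : ℕ) : ℝ≥0∞ :=
  ∑' l : Word n, ENNReal.ofReal (Real.exp (birkhoff φ n (periodicPoint l.1)))

/-- `φ` has (finite) pressure `P(φ) = p`, i.e. `(1/n) log ∑_{𝐚∈ℕⁿ} exp(S_nφ(𝐚^∞)) → p`. -/
def HasPressure (φ : ℝ → ℝ) (p : ℝ) : Prop :=
  (∀ n : ℕ, 0 < n → partSum φ n ≠ ⊤) ∧
    Tendsto (fun n : ℕ => Real.log (partSum φ n).toReal / (n : ℝ)) atTop (𝓝 p)

/-- The pressure of `φ` is finite: `P(φ) < ∞`. -/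
def PressureFinite (φ : ℝ → ℝ) : Prop := ∃ p : ℝ, HasPressure φ p

/-- `φ` is locally Hölder: oscillation on `n`-cylinders decays geometrically. -/
def LocHolder (φ : ℝ → ℝ) : Prop :=
  ∃ C > (0:ℝ), ∃ θ ∈ Set.Ioo (0:ℝ) 1, ∀ l : List ℕ, l ≠ [] → (∀ a ∈ l, 0 < a) →
    ∀ x ∈ cylinder l, ∀ y ∈ cylinder l, |φ x - φ y| ≤ C * θ ^ l.length

/-- The normalization `𝓛_φ 1 = 1` of the Ruelle transfer operator of `φ`. -/
def TransferNormalized (φ : ℝ → ℝ) : Prop :=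
  ∀ x ∈ gaussSet, ∑' a : ℕ+, Real.exp (φ (invBranch1 (a : ℕ) x)) = 1

/-- `μ` is invariant under the Gauss map. -/
def GaussInvariant (μ : Measure ℝ) : Prop :=
  ∀ s : Set ℝ, MeasurableSet s → μ (gaussMap ⁻¹' s) = μ s

/-- The Gibbs property for the potential `φ` (with `P(φ) = 0`):
`C⁻¹ e^{S_nφ(T_𝐚 x)} ≤ μ(I_𝐚) ≤ C e^{S_nφ(T_𝐚 x)}`. -/
def IsGibbs (φ : ℝ → ℝ) (μ : Measure ℝ) : Prop :=
  ∃ C : ℝ, 1 ≤ C ∧ ∀ l : List ℕ, l ≠ [] → (∀ a ∈ l, 0 < a) → ∀ x ∈ gaussSet,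
    C⁻¹ * Real.exp (birkhoff φ l.length (invBranch l x)) ≤ (μ (cylinder l)).toReal ∧
      (μ (cylinder l)).toReal ≤ C * Real.exp (birkhoff φ l.length (invBranch l x))

/-- The Kolmogorov–Sinai entropy of `μ`:
`h = lim (1/n) ∑_{𝐚∈ℕⁿ} -μ(I_𝐚) log μ(I_𝐚)`. -/
def HasEntropy (μ : Measure ℝ) (h : ℝ) : Prop :=
  Tendsto (fun n : ℕ => (∑' l : Word n, Real.negMulLog (μ (cylinder l.1)).toReal) / (n : ℝ))
    atTop (𝓝 h)

/-- `log |T'| (x) = log (1/x²)` for the Gauss map. -/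
def logAbsDerivGauss (x : ℝ) : ℝ := Real.log (1 / x ^ 2)

/-- The observable `ψ = -log |T'|`. -/
def gaussPsi (x : ℝ) : ℝ := -Real.log (1 / x ^ 2)

/-- The Lyapunov exponent `λ_μ = ∫ log|T'| dμ`. -/
def lyapunov (μ : Measure ℝ) : ℝ := ∫ x, logAbsDerivGauss x ∂μ

/-- The polynomial tail condition `μ({x : a₁(x) ≥ n}) = O(n^{-δ})`. -/
def PolyTail (μ : Measure ℝ) : Prop :=
  ∃ δ > (0:ℝ), ∃ K : ℝ, ∀ n : ℕ, 0 < n →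
    (μ {x | x ∈ gaussSet ∧ n ≤ cfDigit1 x}).toReal ≤ K * (n : ℝ) ^ (-δ)

/-- The Fourier transform `μ̂(ξ) = ∫ e^{-2πiξx} dμ(x)`. -/
def muFourier (μ : Measure ℝ) (ξ : ℝ) : ℂ :=
  ∫ x, Complex.exp (-(2 * Real.pi * ξ * x : ℝ) * Complex.I) ∂μ

/-- A sequence `u` equidistributes modulo 1. -/
def EquidistributedMod1 (u : ℕ → ℝ) : Prop :=
  ∀ a b : ℝ, 0 ≤ a → a ≤ b → b ≤ 1 →
    Tendsto (fun N : ℕ =>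
        (((Finset.range N).filter fun k => Int.fract (u k) ∈ Set.Ico a b).card : ℝ) / (N : ℝ))
      atTop (𝓝 (b - a))

/-- The set `B(𝒜)` of `𝒜`-badly approximable numbers: all digits lie in `𝒜`. -/
def badSet (A : Finset ℕ) : Set ℝ := {x | x ∈ gaussSet ∧ ∀ i : ℕ, cfDigit i x ∈ A}

/-- Locally Hölder on the subsystem `B(𝒜)`. -/
def LocHolderOn (A : Finset ℕ) (φ : ℝ → ℝ) : Prop :=
  ∃ C > (0:ℝ), ∃ θ ∈ Set.Ioo (0:ℝ) 1, ∀ l : List ℕ, l ≠ [] → (∀ a ∈ l, a ∈ A) →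
    ∀ x ∈ cylinder l ∩ badSet A, ∀ y ∈ cylinder l ∩ badSet A,
      |φ x - φ y| ≤ C * θ ^ l.length

/-- The Gibbs property for the Gauss map restricted to `B(𝒜)`. -/
def IsGibbsOn (A : Finset ℕ) (φ : ℝ → ℝ) (μ : Measure ℝ) : Prop :=
  ∃ C : ℝ, 1 ≤ C ∧ ∀ l : List ℕ, l ≠ [] → (∀ a ∈ l, a ∈ A) → ∀ x ∈ badSet A,
    C⁻¹ * Real.exp (birkhoff φ l.length (invBranch l x)) ≤ (μ (cylinder l)).toReal ∧
      (μ (cylinder l)).toReal ≤ C * Real.exp (birkhoff φ l.length (invBranch l x))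

/-- The `n`-regular set `A_n(ε)` of the large deviation decomposition. -/
def regSet (φ : ℝ → ℝ) (lam s ε : ℝ) (n : ℕ) : Set ℝ :=
  {x | |birkhoff gaussPsi n x / (n : ℝ) + lam| < ε ∧
       |birkhoff φ n x / birkhoff gaussPsi n x - s| < ε}

/-- The collection `𝓡ₙ` of `n`-regular words. -/
def regWords (φ : ℝ → ℝ) (lam s ε : ℝ) (n : ℕ) : Set (List ℕ) :=
  {l | l.length = n ∧ (∀ a ∈ l, 0 < a) ∧
       ∀ k : ℕ, n / 2 ≤ k → k ≤ n → cylinder (l.take k) ⊆ regSet φ lam s ε k}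

/-- The union `Rₙ` of the `n`-regular cylinders. -/
def regUnion (φ : ℝ → ℝ) (lam s ε : ℝ) (n : ℕ) : Set ℝ :=
  ⋃ l ∈ regWords φ lam s ε n, cylinder l

end

lemma measurable_gaussMap : Measurable gaussMap :=
  measurable_fract.comp measurable_inv

lemma measurable_cfDigit (i : ℕ) : Measurable (cfDigit i) :=
  (Nat.measurable_floor.comp measurable_inv).comp (measurable_gaussMap.iterate i)

lemma measurableSet_gaussSet : MeasurableSet gaussSet :=
  measurableSet_Icc.inter (Set.countable_range ((↑) : ℚ → ℝ)).measurableSet.compl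

lemma measurableSet_cylinder (l : List ℕ) : MeasurableSet (cylinder l) := by
  have h : cylinder l = gaussSet ∩ ⋂ i : Fin l.length, cfDigit i.1 ⁻¹' {l.get i} := by
    ext x
    simp [_root_.cylinder]
  rw [h]
  exact measurableSet_gaussSet.inter
    (MeasurableSet.iInter fun i => measurable_cfDigit _ (measurableSet_singleton _))

lemma cylinder_subset_Icc (l : List ℕ) : cylinder l ⊆ Icc 0 1 := fun _ hx => hx.1.1

lemma gaussMap_mem_gaussSet {x : ℝ} (hx : x ∈ gaussSet) : gaussMap x ∈ gaussSet := by
  refine ⟨⟨Int.fract_nonneg _, (Int.fract_lt_one _).le⟩, ?_⟩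
  have h : Irrational x⁻¹ := irrational_inv_iff.mpr hx.2
  exact h.sub_intCast _

lemma mem_cylinder_cons {a : ℕ} {l : List ℕ} {x : ℝ} :
    x ∈ cylinder (a :: l) ↔ x ∈ gaussSet ∧ cfDigit1 x = a ∧ gaussMap x ∈ cylinder l := by
  constructor
  · rintro ⟨hx, h⟩
    exact ⟨hx, h ⟨0, by simp⟩, gaussMap_mem_gaussSet hx, fun i => h i.succ⟩
  · rintro ⟨hx, h0, -, h⟩
    refine ⟨hx, fun i => ?_⟩
    induction i using Fin.cases with
    | zero => exact h0
    | succ i => exact h i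

lemma gaussMap_eq_inv_sub {x : ℝ} (hx : x ∈ gaussSet) : gaussMap x = x⁻¹ - cfDigit1 x := by
  have h : (0 : ℝ) ≤ x⁻¹ := inv_nonneg.mpr hx.1.1
  rw [gaussMap, cfDigit1, Int.fract, natCast_floor_eq_intCast_floor h]

/-- Cylinders are relatively order-convex in `gaussSet`. -/
lemma mem_cylinder_of_le_of_le {l : List ℕ} : ∀ {x y z : ℝ}, x ∈ cylinder l → y ∈ cylinder l →
    z ∈ gaussSet → x ≤ z → z ≤ y → z ∈ cylinder l := by
  induction l with
  | nil => exact fun _ _ hz _ _ => ⟨hz, fun i => i.elim0⟩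
  | cons a l ih =>
    intro x y z hx hy hz hxz hzy
    rw [mem_cylinder_cons] at hx hy ⊢
    obtain ⟨hx, hxa, hxl⟩ := hx
    obtain ⟨hy, hya, hyl⟩ := hy
    have hx0 : 0 < x := lt_of_le_of_ne hx.1.1 hx.2.ne_zero.symm
    have hz0 : 0 < z := hx0.trans_le hxz
    have hzx : z⁻¹ ≤ x⁻¹ := inv_anti₀ hx0 hxz
    have hyz : y⁻¹ ≤ z⁻¹ := inv_anti₀ hz0 hzy
    have hza : cfDigit1 z = a :=
      le_antisymm (hxa ▸ Nat.floor_le_floor hzx) (hya ▸ Nat.floor_le_floor hyz)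
    refine ⟨hz, hza, ih hyl hxl (gaussMap_mem_gaussSet hz) ?_ ?_⟩
    · rw [gaussMap_eq_inv_sub hy, gaussMap_eq_inv_sub hz, hya, hza]
      linarith
    · rw [gaussMap_eq_inv_sub hx, gaussMap_eq_inv_sub hz, hxa, hza]
      linarith

lemma volume_cylinder_ne_top (l : List ℕ) : volume (cylinder l) ≠ ⊤ :=
  measure_ne_top_of_subset (cylinder_subset_Icc l) measure_Icc_lt_top.ne

lemma diam_cylinder_le_volume (l : List ℕ) : Metric.diam (cylinder l) ≤ volume.real (cylinder l) := by
  have key : ∀ x ∈ cylinder l, ∀ y ∈ cylinder l, x ≤ y → y - x ≤ volume.real (cylinder l) := by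
    intro x hx y hy hxy
    have hsub : Icc x y \ range ((↑) : ℚ → ℝ) ⊆ cylinder l := fun z hz =>
      mem_cylinder_of_le_of_le hx hy
        ⟨⟨hx.1.1.1.trans hz.1.1, hz.1.2.trans hy.1.1.2⟩, hz.2⟩ hz.1.1 hz.1.2
    have h := measureReal_mono hsub (volume_cylinder_ne_top l)
    rwa [measureReal_def, measure_sdiff_null ((countable_range _).measure_zero _),
      Real.volume_Icc, ENNReal.toReal_ofReal (sub_nonneg.mpr hxy)] at h
  refine Metric.diam_le_of_forall_dist_le measureReal_nonneg fun x hx y hy => ?_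
  rw [Real.dist_eq]
  exact abs_sub_le_iff.mpr ⟨(le_total y x).elim (key y hy x hx)
    fun h => (sub_nonpos.mpr h).trans measureReal_nonneg, (le_total x y).elim (key x hx y hy)
    fun h => (sub_nonpos.mpr h).trans measureReal_nonneg⟩

lemma disjoint_cylinder {l l' : List ℕ} (hlen : l.length = l'.length) (hne : l ≠ l') :
    Disjoint (cylinder l) (cylinder l') := by
  refine Set.disjoint_left.mpr fun x hx hx' => hne (List.ext_getElem hlen fun i h h' => ?_)
  exact (hx.2 ⟨i, h⟩).symm.trans (hx'.2 ⟨i, h'⟩)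

lemma le_norm_of_mem_cylinder_of_two_mul_lt_norm {f : ℝ → ℂ} {l : List ℕ} {L D : ℝ}
    (hf : ContDiff ℝ 1 f) (hL : ∀ x ∈ Icc (0:ℝ) 1, ‖deriv f x‖ ≤ L)
    (hD : Metric.diam (cylinder l) ≤ D) (hL0 : 0 ≤ L) {x y : ℝ} (hx : x ∈ cylinder l)
    (hy : y ∈ cylinder l) (hfx : 2 * (L * D) < ‖f x‖) : L * D ≤ ‖f y‖ := by
  have hxy : ‖f x - f y‖ ≤ L * ‖x - y‖ :=
    (convex_Icc (0:ℝ) 1).norm_image_sub_le_of_norm_deriv_le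
      (fun z _ => hf.differentiable one_ne_zero z) hL
      (cylinder_subset_Icc l hy) (cylinder_subset_Icc l hx)
  have hdist : ‖x - y‖ ≤ D := by
    rw [← dist_eq_norm]
    exact (Metric.dist_le_diam_of_mem (Metric.isBounded_Icc 0 1 |>.subset
      (cylinder_subset_Icc l)) hx hy).trans hD
  have h1 := norm_sub_norm_le (f x) (f y)
  have h2 := mul_le_mul_of_nonneg_left hdist hL0
  linarith

/-- Comparison of measures on each piece of a countable disjoint union passes to the union. -/
lemma measureReal_biUnion_cylinder_le {μ : Measure ℝ} [IsFiniteMeasure μ] {B : Set (List ℕ)} {m : ℕ}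
    {M : ℝ} (hM : 0 ≤ M) (hB : ∀ l ∈ B, l.length = m)
    (h : ∀ l ∈ B, μ.real (cylinder l) ≤ M * volume.real (cylinder l)) :
    μ.real (⋃ l ∈ B, cylinder l) ≤ M * volume.real (⋃ l ∈ B, cylinder l) := by
  have hdisj : B.PairwiseDisjoint cylinder := fun l hl l' hl' hne =>
    disjoint_cylinder ((hB l hl).trans (hB l' hl').symm) hne
  have hvol : volume (⋃ l ∈ B, cylinder l) ≠ ⊤ :=
    measure_ne_top_of_subset (iUnion₂_subset fun l _ => cylinder_subset_Icc l)
      measure_Icc_lt_top.ne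
  have hle : μ (⋃ l ∈ B, cylinder l) ≤ ENNReal.ofReal M * volume (⋃ l ∈ B, cylinder l) := by
    rw [measure_biUnion B.to_countable hdisj fun l _ => measurableSet_cylinder l,
      measure_biUnion B.to_countable hdisj fun l _ => measurableSet_cylinder l,
      ← ENNReal.tsum_mul_left]
    refine ENNReal.tsum_le_tsum fun l => ?_
    rw [← ofReal_measureReal (measure_ne_top μ _),
      ← ofReal_measureReal (volume_cylinder_ne_top _), ← ENNReal.ofReal_mul hM]
    exact ENNReal.ofReal_le_ofReal (h l l.2)
  have := ENNReal.toReal_mono (ENNReal.mul_ne_top ENNReal.ofReal_ne_top hvol) hle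
  rwa [ENNReal.toReal_mul, ENNReal.toReal_ofReal hM] at this

lemma sq_mul_volume_le_setIntegral {f : ℝ → ℂ} (hf : Continuous f) {U : Set ℝ} {c : ℝ}
    (hU : MeasurableSet U) (hU01 : U ⊆ Icc 0 1) (hc : 0 ≤ c) (h : ∀ x ∈ U, c ≤ ‖f x‖) :
    c ^ 2 * volume.real U ≤ ∫ x in Icc (0:ℝ) 1, ‖f x‖ ^ 2 := by
  have hint : IntegrableOn (fun x => ‖f x‖ ^ 2) (Icc (0:ℝ) 1) :=
    (by fun_prop : Continuous fun x => ‖f x‖ ^ 2).continuousOn.integrableOn_compact isCompact_Icc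
  calc c ^ 2 * volume.real U = ∫ _ in U, c ^ 2 := by
        rw [setIntegral_const, smul_eq_mul, mul_comm]
    _ ≤ ∫ x in U, ‖f x‖ ^ 2 := by
        refine setIntegral_mono_on (integrableOn_const
          (measure_ne_top_of_subset hU01 measure_Icc_lt_top.ne)) (hint.mono_set hU01) hU
          fun x hx => ?_
        exact pow_le_pow_left₀ hc (h x hx) 2
    _ ≤ ∫ x in Icc (0:ℝ) 1, ‖f x‖ ^ 2 :=
        setIntegral_mono_set hint (ae_of_all _ fun _ => by positivity) hU01.eventuallyLE

lemma integral_norm_le_of_exceptional_sets {μ : Measure ℝ} [IsProbabilityMeasure μ]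
    {f : ℝ → ℂ} {t : ℝ} {U V : Set ℝ} (ht : 0 ≤ t) (hf : Continuous f)
    (hU : MeasurableSet U) (hV : MeasurableSet V)
    (hf1 : ∀ᵐ x ∂μ, ‖f x‖ ≤ 1) (h : ∀ᵐ x ∂μ, x ∉ U → x ∉ V → ‖f x‖ ≤ t) :
    ∫ x, ‖f x‖ ∂μ ≤ t + μ.real U + μ.real V := by
  have hiU : Integrable (U.indicator fun _ => (1:ℝ)) μ := (integrable_const 1).indicator hU
  have hiV : Integrable (V.indicator fun _ => (1:ℝ)) μ := (integrable_const 1).indicator hV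
  have hif : Integrable (fun x => ‖f x‖) μ :=
    Integrable.of_bound hf.norm.aestronglyMeasurable 1 (by simpa using hf1)
  calc ∫ x, ‖f x‖ ∂μ
      ≤ ∫ x, (t + U.indicator (fun _ => (1:ℝ)) x + V.indicator (fun _ => (1:ℝ)) x) ∂μ := by
        refine integral_mono_ae hif (((integrable_const t).add hiU).add hiV) ?_
        filter_upwards [hf1, h] with x h1 h2
        by_cases hxU : x ∈ U <;> by_cases hxV : x ∈ V <;> simp [hxU, hxV] <;>
          first | linarith | exact h2 hxU hxV
    _ = t + μ.real U + μ.real V := by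
        have hitU : Integrable (fun x => t + U.indicator (fun _ => (1:ℝ)) x) μ :=
          (integrable_const t).add hiU
        rw [integral_add hitU hiV, integral_add (integrable_const t) hiU]
        simp [hU, hV, integral_indicator_const]

lemma mul_natFloor_le {x : ℝ} (hx : 0 ≤ x) (c : ℝ) : c * (⌊x⌋₊ : ℝ) ≤ |c| + c * x := by
  have h1 := Nat.floor_le hx
  have h2 := (Nat.lt_floor_add_one x).le
  have h : |c * (⌊x⌋₊ - x)| ≤ |c| * 1 := by
    rw [abs_mul]
    exact mul_le_mul_of_nonneg_left (abs_le.mpr ⟨by linarith, by linarith⟩) (abs_nonneg c)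
  have := le_abs_self (c * (⌊x⌋₊ - x))
  linarith

lemma exp_mul_natFloor_le {x : ℝ} (hx : 0 ≤ x) (a b c : ℝ) (h : a + c * x ≤ b) :
    Real.exp (a + c * (⌊x⌋₊ : ℝ)) ≤ Real.exp |c| * Real.exp b := by
  rw [← Real.exp_add]
  exact Real.exp_le_exp.mpr (by linarith [mul_natFloor_le hx c])

/-- Transfer from the Gibbs measure to Lebesgue: if `α, β > 0` with
`γ = α + β ≥ 1`, then there is a constant `K` (independent of `n` and `f`) such that
for every `C¹` function `f : [0,1] → ℂ` with `‖f‖_∞ ≤ 1` and `‖f'‖_∞ ≤ e^{αλn}`,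
`∫|f| dμ ≤ K (e^{(-βλ+εγ)n} + ‖f‖₂² e^{((1-s)αλ+(3-s)βλ+3λεγ)n} + e^{-δγn/4})`. -/
theorem gibbs_to_lebesgue_large_sieve
    (φ : ℝ → ℝ) (μ : MeasureTheory.Measure ℝ) [MeasureTheory.IsProbabilityMeasure μ]
    (lam s ε δ C : ℝ) (n₀ : ℕ)
    (hμX : μ gaussSet = 1)
    (hε : 0 < ε) (hδ : 0 < δ) (hC : 1 ≤ C) (hlam : 0 < lam) (hs : 0 < s)
    (hreg : ∀ m : ℕ, n₀ ≤ m → ∀ l ∈ regWords φ lam s ε m, ∀ k : ℕ, m / 2 ≤ k → k ≤ m →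
      ((1/16 : ℝ) * Real.exp ((-lam - ε) * k) ≤ Metric.diam (cylinder (l.take k)) ∧
        Metric.diam (cylinder (l.take k)) ≤ Real.exp ((-lam + ε) * k)) ∧
      (C⁻¹ * Real.exp ((-(s * lam) - 3 * lam * ε) * k) ≤ (μ (cylinder (l.take k))).toReal ∧
        (μ (cylinder (l.take k))).toReal ≤ C * Real.exp ((-(s * lam) + 3 * lam * ε) * k)))
    (hcomp : ∀ m : ℕ, n₀ ≤ m →
      (μ (Set.Icc (0:ℝ) 1 \ regUnion φ lam s ε m)).toReal ≤ Real.exp (-(δ * m / 4)))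
    (α β : ℝ) (hα : 0 < α) (hβ : 0 < β) (hγ : 1 ≤ α + β) :
    ∃ K : ℝ, 0 < K ∧ ∀ n : ℕ, n₀ ≤ n → ∀ f : ℝ → ℂ, ContDiff ℝ 1 f →
      (∀ x ∈ Set.Icc (0:ℝ) 1, ‖f x‖ ≤ 1) →
      (∀ x ∈ Set.Icc (0:ℝ) 1, ‖deriv f x‖ ≤ Real.exp (α * lam * n)) →
      ∫ x, ‖f x‖ ∂μ ≤ K * (Real.exp ((-(β * lam) + ε * (α + β)) * n)
        + (∫ x in Set.Icc (0:ℝ) 1, ‖f x‖ ^ 2) *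
            Real.exp (((1 - s) * α * lam + (3 - s) * β * lam + 3 * lam * ε * (α + β)) * n)
        + Real.exp (-(δ * (α + β) * n / 4))) := by
  refine ⟨2 * Real.exp |-lam + ε| + 16 * C * Real.exp |3 * lam - s * lam + 3 * lam * ε - ε|
    + Real.exp |-(δ / 4)|, by positivity, fun n hn f hf hf1 hf' => ?_⟩
  have hγn : 0 ≤ (α + β) * n := by positivity
  set m := ⌊(α + β) * n⌋₊ with hm
  have hnm : n₀ ≤ m := hn.trans (Nat.le_floor (le_mul_of_one_le_left n.cast_nonneg hγ))
  set L := Real.exp (α * lam * n) with hL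
  set D := Real.exp ((-lam + ε) * m) with hD
  set R := regWords φ lam s ε m with hR
  set B := {l ∈ R | ∃ x ∈ cylinder l, 2 * (L * D) < ‖f x‖} with hB
  set U := ⋃ l ∈ B, cylinder l with hU
  set V := Icc (0:ℝ) 1 \ regUnion φ lam s ε m with hV
  have hUm : MeasurableSet U :=
    MeasurableSet.biUnion B.to_countable fun l _ => measurableSet_cylinder l
  have hVm : MeasurableSet V := measurableSet_Icc.diff
    (MeasurableSet.biUnion R.to_countable fun l _ => measurableSet_cylinder l)
  have hreg' : ∀ l ∈ R, ((1/16 : ℝ) * Real.exp ((-lam - ε) * m) ≤ Metric.diam (cylinder l) ∧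
      Metric.diam (cylinder l) ≤ D) ∧
      μ.real (cylinder l) ≤ C * Real.exp ((-(s * lam) + 3 * lam * ε) * m) := by
    intro l hl
    have h := hreg m hnm l hl m (Nat.div_le_self m 2) le_rfl
    rw [List.take_of_length_le hl.1.le] at h
    exact ⟨h.1, h.2.2⟩
  have hX : ∀ᵐ x ∂μ, x ∈ gaussSet :=
    (mem_ae_iff_prob_eq_one measurableSet_gaussSet).mpr hμX
  have hsplit : ∫ x, ‖f x‖ ∂μ ≤ 2 * (L * D) + μ.real U + μ.real V := by
    refine integral_norm_le_of_exceptional_sets (by positivity) hf.continuous hUm hVm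
      (hX.mono fun x hx => hf1 x hx.1) (hX.mono fun x hx hxU hxV => ?_)
    obtain ⟨l, hl, hxl⟩ : ∃ l ∈ R, x ∈ cylinder l := by
      by_contra hcon
      refine hxV ⟨hx.1, fun hmem => hcon ?_⟩
      simpa [regUnion] using hmem
    by_contra! hlt
    exact hxU (mem_biUnion (show l ∈ B from ⟨hl, x, hxl, hlt⟩) hxl)
  have hLD : L * D ≤ Real.exp |-lam + ε| * Real.exp ((-(β * lam) + ε * (α + β)) * n) := by
    rw [hL, hD, ← Real.exp_add]
    exact exp_mul_natFloor_le hγn _ _ _ (by linarith)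
  have hVle : μ.real V ≤ Real.exp |-(δ / 4)| * Real.exp (-(δ * (α + β) * n / 4)) := by
    refine (hcomp m hnm).trans ?_
    rw [show -(δ * m / 4) = 0 + -(δ / 4) * m by ring]
    exact exp_mul_natFloor_le hγn _ _ _ (by linarith)
  have hvolU : (L * D) ^ 2 * volume.real U ≤ ∫ x in Icc (0:ℝ) 1, ‖f x‖ ^ 2 := by
    refine sq_mul_volume_le_setIntegral hf.continuous hUm
      (iUnion₂_subset fun l _ => cylinder_subset_Icc l) (by positivity) fun y hy => ?_
    obtain ⟨l, ⟨hl, x, hx, hfx⟩, hy⟩ := mem_iUnion₂.mp hy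
    exact le_norm_of_mem_cylinder_of_two_mul_lt_norm hf hf' (hreg' l hl).1.2 (Real.exp_pos _).le
      hx hy hfx
  set E := (lam + ε - s * lam + 3 * lam * ε) * m with hE
  have hμU : μ.real U ≤ 16 * C * Real.exp E * volume.real U := by
    refine measureReal_biUnion_cylinder_le (by positivity) (fun l hl => hl.1.1) fun l hl => ?_
    obtain ⟨⟨hlow, -⟩, hμl⟩ := hreg' l hl.1
    calc μ.real (cylinder l) ≤ C * Real.exp ((-(s * lam) + 3 * lam * ε) * m) := hμl
      _ = 16 * C * Real.exp E * ((1/16 : ℝ) * Real.exp ((-lam - ε) * m)) := by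
          have : Real.exp ((-(s * lam) + 3 * lam * ε) * m)
              = Real.exp E * Real.exp ((-lam - ε) * m) := by
            rw [← Real.exp_add, hE]
            ring_nf
          rw [this]
          ring
      _ ≤ _ := by
          gcongr
          exact hlow.trans (diam_cylinder_le_volume l)
  set F := ∫ x in Icc (0:ℝ) 1, ‖f x‖ ^ 2 with hF
  have hF0 : 0 ≤ F := integral_nonneg fun _ => by positivity
  set P := Real.exp (((1 - s) * α * lam + (3 - s) * β * lam + 3 * lam * ε * (α + β)) * n) with hP
  set c := 3 * lam - s * lam + 3 * lam * ε - ε with hc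
  have hexp : Real.exp E = Real.exp (-(2 * α * lam * n) + c * m) * (L * D) ^ 2 := by
    rw [hL, hD, ← Real.exp_add, ← Real.exp_nat_mul, ← Real.exp_add, hE, hc]
    congr 1
    push_cast
    ring
  have hUle : μ.real U ≤ 16 * C * (Real.exp |c| * P) * F := by
    calc μ.real U ≤ 16 * C * Real.exp E * volume.real U := hμU
      _ = 16 * C * Real.exp (-(2 * α * lam * n) + c * m) * ((L * D) ^ 2 * volume.real U) := by
          rw [hexp]
          ring
      _ ≤ _ := by
          gcongr
          refine exp_mul_natFloor_le hγn _ _ _ ?_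
          have : 0 ≤ ε * ((α + β) * n) := by positivity
          rw [hc]
          linarith
  set a := Real.exp |-lam + ε|
  set b := Real.exp |c|
  set d := Real.exp |-(δ / 4)|
  set A₁ := Real.exp ((-(β * lam) + ε * (α + β)) * n)
  set A₃ := Real.exp (-(δ * (α + β) * n / 4))
  have hcross : 0 ≤ 2 * a * (F * P + A₃) + 16 * C * b * (A₁ + A₃) + d * (A₁ + F * P) := by
    positivity
  linarith
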